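/- Smooth min-entropy lower bound for independent experiments: for (X^n, Z^n) with product distribution ∏_j P_{X_j Z_j} on finite alphabets, and any δ > 0, setting ε = 2^{−nδ²/(2 log²(|X|+3))}, the ε-smooth conditional min-entropy satisfies H_∞^ε(X^n|Z^n) ≥ H(X^n|Z^n) − nδ. -/

import Mathlib

open scoped Classical

/-- Statistical distance between two distributions on a finite set. -/
noncomputable def SD {W : Type*} [Fintype W] (P Q : W → ℝ) : ℝ :=
  (1 / 2) * ∑ w, |P w - Q w|

/-- Conditional probability `P_{X|Z}(x|z)` of a joint distribution on `X × Z`. -/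
noncomputable def condProb {X Z : Type*} [Fintype X] (P : X × Z → ℝ) (x : X) (z : Z) : ℝ :=
  P (x, z) / ∑ x' : X, P (x', z)

/-- Conditional Shannon entropy `H(X|Z)` of a joint distribution on `X × Z`. -/
noncomputable def condEnt {X Z : Type*} [Fintype X] [Fintype Z] (P : X × Z → ℝ) : ℝ :=
  - ∑ x : X, ∑ z : Z, P (x, z) * Real.logb 2 (condProb P x z)

/-- Worst-case conditional min-entropy
`H_∞(X|Z) = −log₂ max_{x, z : P_Z(z) > 0} P_{X|Z}(x|z)` of a joint distribution. -/
noncomputable def condMinEnt {X Z : Type*} [Fintype X] [Fintype Z] (P : X × Z → ℝ) : ℝ :=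
  - Real.logb 2 (⨆ x : X, ⨆ z : Z,
      if 0 < ∑ x' : X, P (x', z) then condProb P x z else 0)

/-- `ε`-smooth conditional min-entropy: maximum of `H_∞` over probability
distributions within statistical distance `ε` of `P`. -/
noncomputable def smoothCondMinEnt {X Z : Type*} [Fintype X] [Fintype Z]
    (P : X × Z → ℝ) (ε : ℝ) : ℝ :=
  ⨆ q : {q : X × Z → ℝ // (∀ w, 0 ≤ q w) ∧ (∑ w, q w = 1) ∧ SD q P ≤ ε},
    condMinEnt q.1

/-- Capping the conditional probabilities at `t`. -/
lemma smoothing {X Z : Type*} [Fintype X] [Fintype Z] (P : X × Z → ℝ)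
    (h0 : ∀ w, 0 ≤ P w) (h1 : ∑ w, P w = 1) (t : ℝ) (ht : 0 < t)
    (hc : 1 ≤ (Fintype.card X : ℝ) * t) :
    ∃ q : X × Z → ℝ, (∀ w, 0 ≤ q w) ∧ (∑ w, q w = 1) ∧
      SD q P ≤ ∑ w : X × Z, (if t * ∑ x', P (x', w.2) < P w then P w else 0) ∧
      ∀ x z, q (x, z) ≤ t * ∑ x', q (x', z) := by
  have key : ∀ z, ∃ g : X → ℝ, (∀ x, 0 ≤ g x) ∧ (∑ x, g x = ∑ x, P (x, z)) ∧
      (∑ x, |g x - P (x, z)| ≤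
        2 * ∑ x, (if t * ∑ x', P (x', z) < P (x, z) then P (x, z) else 0)) ∧
      ∀ x, g x ≤ t * ∑ x', P (x', z) := by
    intro z
    set m := ∑ x', P (x', z) with hm
    set c := t * m with hcdef
    have hm0 : 0 ≤ m := Finset.sum_nonneg fun _ _ => h0 _
    have hc0 : 0 ≤ c := mul_nonneg ht.le hm0
    set e := ∑ x, (P (x, z) - min (P (x, z)) c) with he
    set R := ∑ x, (c - min (P (x, z)) c) with hR
    have he0 : 0 ≤ e := Finset.sum_nonneg fun x _ => sub_nonneg.2 (min_le_left _ _)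
    have hr0 : ∀ x, 0 ≤ c - min (P (x, z)) c := fun x => sub_nonneg.2 (min_le_right _ _)
    have hR0 : 0 ≤ R := Finset.sum_nonneg fun x _ => hr0 x
    have heR : e ≤ R := by
      rw [he, hR, Finset.sum_sub_distrib, Finset.sum_sub_distrib]
      have : m ≤ ∑ x : X, c := by
        simp only [Finset.sum_const, Finset.card_univ, nsmul_eq_mul, hcdef]
        nlinarith
      linarith
    have hfrac0 : 0 ≤ e / R := div_nonneg he0 hR0
    have hfrac1 : e / R ≤ 1 := div_le_one_of_le₀ heR hR0
    have hRe : R * (e / R) = e := by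
      rcases eq_or_ne R 0 with h | h
      · have : e = 0 := by linarith
        simp [this]
      · field_simp
    have hmin0 : ∀ x, 0 ≤ min (P (x, z)) c := fun x => le_min (h0 _) hc0
    refine ⟨fun x => min (P (x, z)) c + (c - min (P (x, z)) c) * (e / R), ?_, ?_, ?_, ?_⟩
    · intro x
      exact add_nonneg (hmin0 x) (mul_nonneg (hr0 x) hfrac0)
    · rw [Finset.sum_add_distrib, ← Finset.sum_mul, ← hR, hRe, he, Finset.sum_sub_distrib]
      ring
    · calc ∑ x, |min (P (x, z)) c + (c - min (P (x, z)) c) * (e / R) - P (x, z)|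
          ≤ ∑ x, ((P (x, z) - min (P (x, z)) c) + (c - min (P (x, z)) c) * (e / R)) := by
            refine Finset.sum_le_sum fun x _ => ?_
            have h1 := mul_nonneg (hr0 x) hfrac0
            have h2 := min_le_left (P (x, z)) c
            rw [abs_le]; constructor <;> linarith
        _ = 2 * e := by
            rw [Finset.sum_add_distrib, ← Finset.sum_mul, ← hR, hRe, ← he]; ring
        _ ≤ _ := by
            refine mul_le_mul_of_nonneg_left (Finset.sum_le_sum fun x _ => ?_) (by norm_num)
            split_ifs with h
            · linarith [hmin0 x]
            · rw [min_eq_left (not_lt.1 h)]; simp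
    · intro x
      have := mul_le_mul_of_nonneg_left hfrac1 (hr0 x)
      simp only; linarith
  choose g hg0 hg1 hg2 hg3 using key
  refine ⟨fun w => g w.2 w.1, fun w => hg0 _ _, ?_, ?_, ?_⟩
  · rw [Fintype.sum_prod_type_right, ← h1, Fintype.sum_prod_type_right]
    exact Finset.sum_congr rfl fun z _ => hg1 z
  · unfold SD
    rw [Fintype.sum_prod_type_right, Fintype.sum_prod_type_right]
    have : ∑ z, ∑ x, |g z x - P (x, z)| ≤ ∑ z, 2 * ∑ x,
      (if t * ∑ x', P (x', z) < P (x, z) then P (x, z) else 0) :=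
      Finset.sum_le_sum fun z _ => hg2 z
    rw [← Finset.mul_sum] at this
    simp only at this ⊢
    linarith
  · intro x z
    simp only
    rw [hg1 z]; exact hg3 z x

lemma iSup_bdd {X Z : Type*} [Fintype X] [Fintype Z] (f : X → Z → ℝ) (x : X) (z : Z) :
    f x z ≤ ⨆ x, ⨆ z, f x z :=
  (le_ciSup (f := f x) (Set.finite_range _).bddAbove z).trans
    (le_ciSup (f := fun x => ⨆ z, f x z) (Set.finite_range _).bddAbove x)

lemma sup_lower {X Z : Type*} [Fintype X] [Fintype Z] (q : X × Z → ℝ)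
    (h0 : ∀ w, 0 ≤ q w) (h1 : ∑ w, q w = 1) :
    0 < (1 : ℝ) / Fintype.card X ∧ (1 : ℝ) / Fintype.card X ≤ ⨆ x : X, ⨆ z : Z,
      if 0 < ∑ x' : X, q (x', z) then condProb q x z else 0 := by
  obtain ⟨z, hz⟩ : ∃ z, 0 < ∑ x', q (x', z) := by
    by_contra! h
    rw [Fintype.sum_prod_type_right] at h1
    have := Finset.sum_nonpos fun z (_ : z ∈ Finset.univ) => h z
    linarith
  have hne : Nonempty X := by
    by_contra h
    rw [not_nonempty_iff] at h
    simp at hz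
  have hcard : (0 : ℝ) < Fintype.card X := by exact_mod_cast Fintype.card_pos
  refine ⟨by positivity, ?_⟩
  set S := ⨆ x : X, ⨆ z : Z, if 0 < ∑ x' : X, q (x', z) then condProb q x z else 0 with hS
  have hx : ∀ x, q (x, z) ≤ S * ∑ x', q (x', z) := by
    intro x
    have := iSup_bdd (fun x z => if 0 < ∑ x' : X, q (x', z) then condProb q x z else 0) x z
    simp only [hz, if_true, condProb] at this
    rwa [div_le_iff₀ hz] at this
  have := Finset.sum_le_sum fun x (_ : x ∈ Finset.univ) => hx x
  rw [Finset.sum_const, Finset.card_univ, nsmul_eq_mul] at this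
  rw [div_le_iff₀ hcard]
  by_contra! h
  nlinarith

lemma smooth_ge {X Z : Type*} [Fintype X] [Fintype Z] (P : X × Z → ℝ)
    (h0 : ∀ w, 0 ≤ P w) (h1 : ∑ w, P w = 1) (t ε : ℝ) (ht : 0 < t)
    (hc : 1 ≤ (Fintype.card X : ℝ) * t)
    (hε : ∑ w : X × Z, (if t * ∑ x', P (x', w.2) < P w then P w else 0) ≤ ε) :
    -Real.logb 2 t ≤ smoothCondMinEnt P ε := by
  obtain ⟨q, hq0, hq1, hq2, hq3⟩ := smoothing P h0 h1 t ht hc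
  have hb : BddAbove (Set.range fun q : {q : X × Z → ℝ // (∀ w, 0 ≤ q w) ∧ (∑ w, q w = 1) ∧
      SD q P ≤ ε} => condMinEnt q.1) := by
    refine ⟨-Real.logb 2 (1 / Fintype.card X), ?_⟩
    rintro _ ⟨⟨q, a, b, c⟩, rfl⟩
    obtain ⟨u, v⟩ := sup_lower q a b
    exact neg_le_neg (Real.logb_le_logb_of_le (by norm_num) u v)
  refine le_trans ?_ (le_ciSup hb ⟨q, hq0, hq1, hq2.trans hε⟩)
  obtain ⟨u, v⟩ := sup_lower q hq0 hq1
  refine neg_le_neg (Real.logb_le_logb_of_le (by norm_num) (u.trans_le v) ?_)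
  refine Real.iSup_le (fun x => Real.iSup_le (fun z => ?_) ht.le) ht.le
  split_ifs with h
  · unfold condProb
    rw [div_le_iff₀ h]; exact hq3 x z
  · exact ht.le

lemma concave_log_sq : ConcaveOn ℝ (Set.Ici (3 : ℝ)) (fun x => Real.log x ^ 2) := by
  have h3 : Real.exp 1 ≤ 3 := by linarith [Real.exp_one_lt_d9]
  refine AntitoneOn.concaveOn_of_deriv (convex_Ici 3) ?_ ?_ ?_
  · refine ContinuousOn.pow (Real.continuousOn_log.mono ?_) 2
    intro x hx
    have : (3 : ℝ) ≤ x := hx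
    simp; linarith
  · rw [interior_Ici]
    intro x hx
    have : (3 : ℝ) < x := hx
    exact ((Real.differentiableAt_log (by linarith)).pow 2).differentiableWithinAt
  · rw [interior_Ici]
    have hd : ∀ x : ℝ, 3 < x → deriv (fun x => Real.log x ^ 2) x = 2 * (Real.log x / x) := by
      intro x hx
      have := ((Real.hasDerivAt_log (x := x) (by linarith)).pow 2).deriv
      simp only [Pi.pow_def] at this
      rw [this]; simp; ring
    intro x hx y hy hxy
    rw [hd x hx, hd y hy]
    have hx' : (3 : ℝ) < x := hx
    have hy' : (3 : ℝ) < y := hy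
    have := Real.log_div_self_antitoneOn (a := x) (b := y) (by simp; linarith) (by simp; linarith) hxy
    simp only at this
    linarith

lemma exp_neg_le (u : ℝ) (hu : 0 ≤ u) : Real.exp (-u) ≤ 1 - u + u ^ 2 / 2 := by
  have h := Real.quadratic_le_exp_of_nonneg hu
  rw [Real.exp_neg, inv_le_iff_one_le_mul₀ (Real.exp_pos _)]
  have h2 : 0 ≤ 1 - u + u ^ 2 / 2 := by nlinarith [sq_nonneg (u - 1)]
  have := mul_le_mul_of_nonneg_left h h2
  nlinarith [sq_nonneg (u ^ 2)]

lemma le_marg {X Z : Type*} [Fintype X] (P : X × Z → ℝ)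
    (h0 : ∀ w, 0 ≤ P w) (x : X) (z : Z) : P (x, z) ≤ ∑ x', P (x', z) :=
  Finset.single_le_sum (f := fun x' => P (x', z)) (fun _ _ => h0 _) (Finset.mem_univ x)

/-- `∑ P * (P_Z / P) ≤ |X|`. -/
lemma sum_ratio {X Z : Type*} [Fintype X] [Fintype Z] (P : X × Z → ℝ)
    (h0 : ∀ w, 0 ≤ P w) (h1 : ∑ w, P w = 1) :
    ∑ w : X × Z, P w * (condProb P w.1 w.2)⁻¹ ≤ Fintype.card X := by
  calc ∑ w : X × Z, P w * (condProb P w.1 w.2)⁻¹ ≤ ∑ w : X × Z, ∑ x', P (x', w.2) := by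
        refine Finset.sum_le_sum fun w _ => ?_
        have hm : 0 ≤ ∑ x', P (x', w.2) := Finset.sum_nonneg fun _ _ => h0 _
        unfold condProb
        rw [inv_div]
        rcases eq_or_ne (P w) 0 with h | h
        · simpa [h] using hm
        · rw [mul_div_cancel₀ _ h]
    _ = Fintype.card X := by
        rw [Fintype.sum_prod_type]
        simp only
        rw [← Fintype.sum_prod_type_right, h1]
        simp

lemma condProb_mem {X Z : Type*} [Fintype X] (P : X × Z → ℝ)
    (h0 : ∀ w, 0 ≤ P w) (w : X × Z) : 0 ≤ condProb P w.1 w.2 ∧ condProb P w.1 w.2 ≤ 1 := by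
  have hm : 0 ≤ ∑ x', P (x', w.2) := Finset.sum_nonneg fun _ _ => h0 _
  exact ⟨div_nonneg (h0 _) hm, div_le_one_of_le₀ (le_marg P h0 _ _) hm⟩

lemma condProb_pos {X Z : Type*} [Fintype X] (P : X × Z → ℝ)
    (h0 : ∀ w, 0 ≤ P w) (w : X × Z) (hw : 0 < P w) : 0 < condProb P w.1 w.2 :=
  div_pos hw (hw.trans_le (le_marg P h0 _ _))

lemma ent_le {X Z : Type*} [Fintype X] [Fintype Z] (P : X × Z → ℝ)
    (h0 : ∀ w, 0 ≤ P w) (h1 : ∑ w, P w = 1) :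
    0 < (Fintype.card X : ℝ) ∧ -∑ w : X × Z, P w * Real.log (condProb P w.1 w.2) ≤
      Real.log (Fintype.card X) := by
  have hK : 0 < (Fintype.card X : ℝ) := by
    have := (sup_lower P h0 h1).1
    simpa using this
  refine ⟨hK, ?_⟩
  set K := (Fintype.card X : ℝ)
  calc -∑ w : X × Z, P w * Real.log (condProb P w.1 w.2)
      ≤ ∑ w : X × Z, (P w * (Real.log K - 1) + P w * (condProb P w.1 w.2)⁻¹ / K) := by
        rw [← Finset.sum_neg_distrib]
        refine Finset.sum_le_sum fun w _ => ?_
        rcases (h0 w).eq_or_lt with h | h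
        · simp [← h]
        · have hc := condProb_pos P h0 w h
          have := Real.log_le_sub_one_of_pos (x := (condProb P w.1 w.2)⁻¹ / K) (by positivity)
          rw [Real.log_div (by positivity) (by positivity), Real.log_inv] at this
          have h2 := mul_le_mul_of_nonneg_left this h.le
          rw [mul_div_assoc]
          linarith
    _ ≤ Real.log K := by
        rw [Finset.sum_add_distrib, ← Finset.sum_mul, h1, ← Finset.sum_div]
        have := (div_le_one hK).2 (sum_ratio P h0 h1)
        linarith

lemma logsq_le {X Z : Type*} [Fintype X] [Fintype Z] (P : X × Z → ℝ)
    (h0 : ∀ w, 0 ≤ P w) (h1 : ∑ w, P w = 1) :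
    ∑ w : X × Z, P w * Real.log (condProb P w.1 w.2) ^ 2 ≤
      Real.log (Fintype.card X + 3) ^ 2 := by
  have hge : ∀ w : X × Z, 0 ≤ (condProb P w.1 w.2)⁻¹ :=
    fun w => inv_nonneg.2 (condProb_mem P h0 w).1
  have J := concave_log_sq.le_map_sum (t := Finset.univ) (w := P)
    (p := fun w : X × Z => (condProb P w.1 w.2)⁻¹ + 3) (fun w _ => h0 w) h1
    (fun w _ => by simpa using hge w)
  simp only [smul_eq_mul] at J
  have hs : ∑ w : X × Z, P w * ((condProb P w.1 w.2)⁻¹ + 3)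
      = ∑ w : X × Z, P w * (condProb P w.1 w.2)⁻¹ + 3 := by
    simp only [mul_add, Finset.sum_add_distrib]
    rw [← Finset.sum_mul, h1, one_mul]
  have hs0 : 0 ≤ ∑ w : X × Z, P w * (condProb P w.1 w.2)⁻¹ :=
    Finset.sum_nonneg fun w _ => mul_nonneg (h0 w) (hge w)
  rw [hs] at J
  calc _ ≤ _ := ?_
    _ ≤ _ := J
    _ ≤ _ := ?_
  · refine Finset.sum_le_sum fun w _ => ?_
    rcases (h0 w).eq_or_lt with h | h
    · simp [← h]
    · have hc := condProb_pos P h0 w h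
      have hc1 := (condProb_mem P h0 w).2
      have h3 : 1 ≤ (condProb P w.1 w.2)⁻¹ := (one_le_inv₀ hc).2 hc1
      rw [← neg_sq, ← Real.log_inv]
      refine mul_le_mul_of_nonneg_left (pow_le_pow_left₀ (Real.log_nonneg h3) ?_ 2) h.le
      exact Real.log_le_log (by positivity) (by linarith)
  · refine pow_le_pow_left₀ (Real.log_nonneg (by linarith)) ?_ 2
    exact Real.log_le_log (by linarith) (by linarith [sum_ratio P h0 h1])

lemma mgf_le {X Z : Type*} [Fintype X] [Fintype Z] (P : X × Z → ℝ)
    (h0 : ∀ w, 0 ≤ P w) (h1 : ∑ w, P w = 1) (s : ℝ) (hs : 0 ≤ s) :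
    ∑ w : X × Z, P w * Real.exp (s * Real.log (condProb P w.1 w.2)) ≤
      Real.exp (s * ∑ w : X × Z, P w * Real.log (condProb P w.1 w.2) +
        s ^ 2 * Real.log (Fintype.card X + 3) ^ 2 / 2) := by
  refine le_trans ?_ (Real.add_one_le_exp _)
  calc _ ≤ ∑ w : X × Z, (P w + s * (P w * Real.log (condProb P w.1 w.2)) +
          s ^ 2 / 2 * (P w * Real.log (condProb P w.1 w.2) ^ 2)) := by
        refine Finset.sum_le_sum fun w _ => ?_
        have hm := condProb_mem P h0 w
        have hl := Real.log_nonpos hm.1 hm.2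
        have := exp_neg_le (-(s * Real.log (condProb P w.1 w.2))) (by nlinarith)
        rw [neg_neg] at this
        have h2 := mul_le_mul_of_nonneg_left this (h0 w)
        linarith
    _ ≤ _ := by
        rw [Finset.sum_add_distrib, Finset.sum_add_distrib, ← Finset.mul_sum, ← Finset.mul_sum, h1]
        have := mul_le_mul_of_nonneg_left (logsq_le P h0 h1) (by positivity : 0 ≤ s ^ 2 / 2)
        linarith


lemma sum_prod_pair {X Z : Type*} [Fintype X] [Fintype Z] (n : ℕ) (f : Fin n → X × Z → ℝ) :
    ∑ w : (Fin n → X) × (Fin n → Z), ∏ j, f j (w.1 j, w.2 j) = ∏ j, ∑ w, f j w := by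
  rw [Finset.prod_univ_sum, Fintype.piFinset_univ]
  exact Fintype.sum_equiv (Equiv.arrowProdEquivProdArrow (Fin n) (fun _ => X) (fun _ => Z)).symm _ _ (fun w => rfl)

/-- Holenstein–Renner, Theorem 1: smooth min-entropy lower bound
for independent experiments, with `ε = 2^{−nδ²/(2 log²(|X|+3))}`. -/
theorem smooth_min_entropy_lower_bound
    {𝒳 𝒵 : Type*} [Fintype 𝒳] [Fintype 𝒵]
    (n : ℕ) (P : Fin n → 𝒳 × 𝒵 → ℝ)
    (hP : ∀ j, (∀ w, 0 ≤ P j w) ∧ ∑ w, P j w = 1)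
    (δ : ℝ) (hδ : 0 < δ) :
    smoothCondMinEnt
      (fun xz : (Fin n → 𝒳) × (Fin n → 𝒵) => ∏ j, P j (xz.1 j, xz.2 j))
      ((2 : ℝ) ^ (-((n : ℝ) * δ ^ 2) / (2 * (Real.logb 2 ((Fintype.card 𝒳 : ℝ) + 3)) ^ 2)))
    ≥ (∑ j, condEnt (P j)) - n * δ := by
  set PP := (fun xz : (Fin n → 𝒳) × (Fin n → 𝒵) => ∏ j, P j (xz.1 j, xz.2 j)) with hPP
  have g0 : ∀ w, 0 ≤ PP w := fun w => Finset.prod_nonneg fun j _ => (hP j).1 _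
  have g1 : ∑ w, PP w = 1 := by
    rw [hPP, sum_prod_pair n P]
    exact Finset.prod_eq_one fun j _ => (hP j).2
  have marg : ∀ z : Fin n → 𝒵, ∑ x : Fin n → 𝒳, PP (x, z) = ∏ j, ∑ x, P j (x, z j) := by
    intro z
    rw [Finset.prod_univ_sum, Fintype.piFinset_univ]
  set a : Fin n → ℝ := fun j => ∑ w : 𝒳 × 𝒵, P j w * Real.log (condProb (P j) w.1 w.2) with ha
  have hl2 : 0 < Real.log 2 := Real.log_pos (by norm_num)
  have hent : ∀ j, condEnt (P j) = -a j / Real.log 2 := by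
    intro j
    simp only [condEnt, ha, Real.logb, Fintype.sum_prod_type, neg_div, Finset.sum_div, mul_div_assoc]
  set L := Real.log ((Fintype.card 𝒳 : ℝ) + 3) with hL
  have hL0 : 0 < L := Real.log_pos (by linarith [Nat.cast_nonneg (α := ℝ) (Fintype.card 𝒳)])
  set d := δ * Real.log 2 with hd
  have hd0 : 0 < d := by positivity
  set T := ∑ j, a j + n * d with hT
  have hgoal : (∑ j, condEnt (P j)) - n * δ = -Real.logb 2 (Real.exp T) := by
    rw [Finset.sum_congr rfl fun j _ => hent j, ← Finset.sum_div, Finset.sum_neg_distrib,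
      Real.logb, Real.log_exp, hT, hd]
    field_simp
    ring
  rw [hgoal]
  refine smooth_ge PP g0 g1 (Real.exp T) _ (Real.exp_pos _) ?_ ?_
  · have h : ∀ j, 1 ≤ (Fintype.card 𝒳 : ℝ) * Real.exp (a j) := by
      intro j
      obtain ⟨hK, h⟩ := ent_le (P j) (hP j).1 (hP j).2
      rw [← Real.exp_log hK, ← Real.exp_add]
      refine Real.one_le_exp ?_
      simp only [ha]; linarith
    have h2 : 1 ≤ ∏ j, ((Fintype.card 𝒳 : ℝ) * Real.exp (a j)) :=
      le_of_eq_of_le (Finset.prod_const_one (s := Finset.univ)).symm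
        (Finset.prod_le_prod (fun _ _ => zero_le_one) fun j _ => h j)
    rw [Finset.prod_mul_distrib, ← Real.exp_sum] at h2
    have hc : (Fintype.card (Fin n → 𝒳) : ℝ) = ∏ j : Fin n, (Fintype.card 𝒳 : ℝ) := by simp
    rw [hc]
    refine h2.trans (mul_le_mul_of_nonneg_left (Real.exp_le_exp.2 ?_) ?_)
    · rw [hT]
      have : 0 ≤ (n : ℝ) * d := by positivity
      linarith
    · exact Finset.prod_nonneg fun _ _ => Nat.cast_nonneg _
  · set s := d / L ^ 2 with hs
    have hs0 : 0 < s := by positivity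
    have hsL : s * L ^ 2 = d := by rw [hs]; field_simp
    calc _ ≤ ∑ w : (Fin n → 𝒳) × (Fin n → 𝒵), Real.exp (-(s * T)) * ∏ j,
            (P j (w.1 j, w.2 j) *
              Real.exp (s * Real.log (condProb (P j) (w.1 j) (w.2 j)))) := by
          refine Finset.sum_le_sum fun w _ => ?_
          rw [Finset.prod_mul_distrib, ← Real.exp_sum, ← Finset.mul_sum]
          have hpw : ∏ j, P j (w.1 j, w.2 j) = PP w := rfl
          rw [hpw, mul_left_comm, ← Real.exp_add]
          split_ifs with hw
          · refine le_mul_of_one_le_right (g0 w) (Real.one_le_exp ?_)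
            have hm : 0 ≤ ∑ x', PP (x', w.2) := Finset.sum_nonneg fun _ _ => g0 _
            have hpos : 0 < PP w := lt_of_le_of_lt (by positivity) hw
            have hj : ∀ j, 0 < P j (w.1 j, w.2 j) := by
              intro j
              refine lt_of_le_of_ne ((hP j).1 _) fun h => hpos.ne' ?_
              exact Finset.prod_eq_zero (Finset.mem_univ j) h.symm
            have hcj := fun j => condProb_pos (P j) (hP j).1 (w.1 j, w.2 j) (hj j)
            have hmj : ∀ j, 0 < ∑ x, P j (x, w.2 j) := fun j =>
              (hj j).trans_le (le_marg (P j) (hP j).1 _ _)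
            have hmm : 0 < ∑ x', PP (x', w.2) := by
              rw [marg]; exact Finset.prod_pos fun j _ => hmj j
            rw [← Real.log_prod fun j _ => (hcj j).ne']
            have hprod : ∏ j, condProb (P j) (w.1 j) (w.2 j) = PP w / ∑ x', PP (x', w.2) := by
              rw [marg, ← hpw, ← Finset.prod_div_distrib]; rfl
            rw [hprod]
            have := (lt_div_iff₀ hmm).2 hw
            have := (Real.le_log_iff_exp_le (div_pos hpos hmm)).2 this.le
            nlinarith
          · exact mul_nonneg (g0 w) (Real.exp_pos _).le
      _ = Real.exp (-(s * T)) * ∏ j, ∑ w : 𝒳 × 𝒵,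
            (P j w * Real.exp (s * Real.log (condProb (P j) w.1 w.2))) := by
          rw [← Finset.mul_sum, ← sum_prod_pair n]
      _ ≤ Real.exp (-(s * T)) * ∏ j : Fin n, Real.exp (s * a j + s ^ 2 * L ^ 2 / 2) := by
          refine mul_le_mul_of_nonneg_left (Finset.prod_le_prod ?_ ?_) (Real.exp_pos _).le
          · exact fun j _ => Finset.sum_nonneg fun w _ =>
              mul_nonneg ((hP j).1 _) (Real.exp_pos _).le
          · exact fun j _ => mgf_le (P j) (hP j).1 (hP j).2 s hs0.le
      _ = Real.exp (-(n * (d ^ 2 / (2 * L ^ 2)))) := by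
          rw [← Real.exp_sum, ← Real.exp_add, Finset.sum_add_distrib, ← Finset.mul_sum, hT]
          congr 1
          simp only [Finset.sum_const, Finset.card_univ, Fintype.card_fin, nsmul_eq_mul]
          rw [hs]
          field_simp
          ring
      _ ≤ _ := by
          rw [Real.rpow_def_of_pos (by norm_num)]
          refine Real.exp_le_exp.2 ?_
          have hr : Real.log 2 * (-((n : ℝ) * δ ^ 2) / (2 * Real.logb 2 ((Fintype.card 𝒳 : ℝ) + 3) ^ 2))
              = Real.log 2 * -(n * (d ^ 2 / (2 * L ^ 2))) := by
            rw [Real.logb, ← hL, hd]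
            field_simp
          rw [hr]
          have h1 : Real.log 2 ≤ 1 := by linarith [Real.log_two_lt_d9]
          have h2 : 0 ≤ (n : ℝ) * (d ^ 2 / (2 * L ^ 2)) := by positivity
          nlinarith
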